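/- Let n ≥ 1 and j be integers with 0 ≤ j ≤ n, let ν be an integer with 1 ≤ ν ≤ j, and let f : ℝ → ℝ be differentiable at ν. Then the derivative of t ↦ (t-j)_n·f(t) at t = ν equals f(ν) · (ν-j)_{j-ν} · (n+ν-j-1)!, where (ν-j)_{j-ν} = (-1)^{j-ν}(j-ν)!. -/

import Mathlib

open scoped BigOperators

/-- The Pochhammer symbol `(x)_k = x (x+1) ⋯ (x+k-1)` for a real `x`. -/
noncomputable def poch (x : ℝ) (k : ℕ) : ℝ := ∏ i ∈ Finset.range k, (x + i)

/-- The rational function `R_{n,m}(t)` from the paper. -/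
noncomputable def R (n m : ℕ) (t : ℝ) : ℝ :=
  (-1 : ℝ) ^ m * (t + n / 2) * (poch (t - n) m / m.factorial) *
    (poch (t - 2 * n + m) (2 * n - m) / (2 * n - m).factorial) *
    (poch (t + n + 1) n / poch t (n + 1)) *
    (poch (t + n + 1) (2 * n - m) / poch t (2 * n - m + 1)) *
    ((n.factorial : ℝ) / poch t (n + 1)) ^ 2

/-- The rational function `R̃_{n,m}(t)` from the paper. -/
noncomputable def Rtilde (n m : ℕ) (t : ℝ) : ℝ :=
  ((n.factorial : ℝ) * poch (t - n) (2 * n - m) / (poch t (n + 1) * poch t (2 * n - m + 1))) *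
    ∑ j ∈ Finset.range (n + 1),
      (n.choose j : ℝ) ^ 2 * ((2 * n - m + j).choose n : ℝ) * poch (t - j) n / n.factorial

/-- `Z_l(n,m) = -(1/3) Σ_{ν=n-m+1}^∞ (d/dt R_{n,m}(t))|_{t=ν}`. -/
noncomputable def Zl (n m : ℕ) : ℝ :=
  -(1 / 3) * ∑' ν : ℕ, deriv (R n m) ((n : ℝ) - m + 1 + ν)

/-- `Z_r(n,m) = (1/6) Σ_{ν=1}^∞ (d²/dt² R̃_{n,m}(t))|_{t=ν}`. -/
noncomputable def Zr (n m : ℕ) : ℝ :=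
  (1 / 6) * ∑' ν : ℕ, deriv (deriv (Rtilde n m)) (1 + (ν : ℝ))

/-- `U_k(n) = Σ_{i=0}^n C(4i,2i) / ((2i+1)^k C(2i,i)^8)`. -/
noncomputable def U (k n : ℕ) : ℝ :=
  ∑ i ∈ Finset.range (n + 1),
    ((4 * i).choose (2 * i) : ℝ) / ((2 * i + 1) ^ k * ((2 * i).choose i : ℝ) ^ 8)

/-- The harmonic number `S₁(N) = Σ_{i=1}^N 1/i`. -/
noncomputable def S1 (N : ℕ) : ℝ := ∑ i ∈ Finset.range N, (1 : ℝ) / (i + 1)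


theorem poch_add (x : ℝ) (k r : ℕ) : poch x (k + r) = poch x k * poch (x + k) r := by
  simp only [poch, Finset.prod_range_add, Nat.cast_add, add_assoc]

theorem poch_succ_left (x : ℝ) (k : ℕ) : poch x (k + 1) = x * poch (x + 1) k := by
  rw [add_comm, poch_add]
  simp [poch]

theorem poch_one (k : ℕ) : poch 1 k = (k.factorial : ℝ) := by
  simp [poch, ← Finset.prod_range_add_one_eq_factorial, add_comm]

theorem poch_neg_natCast_self (k : ℕ) : poch (-k) k = (-1 : ℝ) ^ k * (k.factorial : ℝ) := by
  induction k with
  | zero => simp [poch]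
  | succ k ih =>
    rw [poch_succ_left, show -((k + 1 : ℕ) : ℝ) + 1 = -k by push_cast; ring, ih,
      Nat.factorial_succ]
    push_cast
    ring

theorem differentiable_poch (k : ℕ) : Differentiable ℝ fun x => poch x k := by
  unfold poch
  fun_prop

/-- The derivative of `(x)_n` at its zero `x = -k`, for `n = k + 1 + r`. -/
theorem hasDerivAt_poch_neg_natCast (k r : ℕ) :
    HasDerivAt (fun x => poch x (k + 1 + r)) (poch (-k) k * (r.factorial : ℝ)) (-k : ℝ) := by
  have hfac : (fun x => poch x (k + 1 + r)) =
      fun x => (x + k) * (poch x k * poch (x + k + 1) r) := by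
    funext x
    rw [add_assoc, poch_add, add_comm 1 r, poch_succ_left]
    ring
  have hg : DifferentiableAt ℝ (fun x => poch x k * poch (x + k + 1) r) (-k : ℝ) :=
    (differentiable_poch k _).mul
      ((differentiable_poch r).comp (by fun_prop : Differentiable ℝ fun x : ℝ => x + k + 1) _)
  rw [hfac]
  refine (((hasDerivAt_id' (-k : ℝ)).add_const (k : ℝ)).fun_mul hg.hasDerivAt).congr_deriv ?_
  simp [poch_one]

/-- For integers `n ≥ 1`, `0 ≤ j ≤ n`, `1 ≤ ν ≤ j` and a function `f` differentiable at `ν`,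
the derivative of `t ↦ (t-j)_n f(t)` at `t = ν` equals `f(ν) (ν-j)_{j-ν} (n+ν-j-1)!`, where
`(ν-j)_{j-ν} = (-1)^{j-ν} (j-ν)!`. -/
theorem deriv_poch_mul' (n j ν : ℕ) (hn : 1 ≤ n) (hj : j ≤ n) (hν1 : 1 ≤ ν) (hνj : ν ≤ j)
    (f : ℝ → ℝ) (hf : DifferentiableAt ℝ f (ν : ℝ)) :
    deriv (fun t : ℝ => poch (t - j) n * f t) (ν : ℝ) =
      f ν * poch ((ν : ℝ) - j) (j - ν) * ((n + ν - j - 1).factorial : ℝ) ∧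
    poch ((ν : ℝ) - j) (j - ν) = (-1 : ℝ) ^ (j - ν) * ((j - ν).factorial : ℝ) := by
  obtain ⟨k, rfl⟩ := Nat.exists_eq_add_of_le hνj
  obtain ⟨r, rfl⟩ := Nat.exists_eq_add_of_le (show k + 1 ≤ n by omega)
  have hx : (ν : ℝ) - (ν + k : ℕ) = -k := by push_cast; ring
  rw [show ν + k - ν = k by omega, show k + 1 + r + ν - (ν + k) - 1 = r by omega, hx]
  refine ⟨?_, poch_neg_natCast_self k⟩
  have hp : HasDerivAt (fun t : ℝ => poch (t - (ν + k : ℕ)) (k + 1 + r))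
      (poch (-k) k * (r.factorial : ℝ)) ν := by
    refine HasDerivAt.comp_sub_const (f := fun x => poch x (k + 1 + r)) _ _ ?_
    rw [hx]
    exact hasDerivAt_poch_neg_natCast k r
  have hzero : poch (-k : ℝ) (k + 1 + r) = 0 :=
    Finset.prod_eq_zero (i := k) (by simp; omega) (by simp)
  rw [(hp.fun_mul hf.hasDerivAt).deriv, hx, hzero]
  ring
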